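/- Let 0 < α < 1 and m, n ∈ ℕ. Then π^{−1} ∫_{ℝ²} h_m^{(α)}(x+iy) · conj(h_n^{(α)}(x+iy)) · exp(−x² − y²) dx dy = 1 if m = n and = 0 if m ≠ n; that is, the holomorphic Hermite functions h_n^{(α)} form an orthonormal system in L²(ℂ, π^{−1} e^{−|z|²} dx dy). -/

import Mathlib

open Finset MeasureTheory
open scoped Nat

/-- The physicists' Hermite polynomial
`H_n(z) = n! ∑_{m=0}^{⌊n/2⌋} (−1)^m (2z)^{n−2m} / (m!(n−2m)!)`, for a complex argument. -/
noncomputable def hermiteH (n : ℕ) (z : ℂ) : ℂ :=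
  (n ! : ℂ) * ∑ m ∈ Finset.range (n / 2 + 1),
    ((-1 : ℂ) ^ m * (2 * z) ^ (n - 2 * m)) / ((m ! : ℂ) * ((n - 2 * m)! : ℂ))

/-- The holomorphic Hermite function
`h_n^{(α)}(z) = (2√α/(1+α))^{1/2} ((1−α)/(1+α))^{n/2} (2^n n!)^{−1/2}
  exp(((1−α)/(1+α)) z²/2) H_n(√(2α/(1−α²)) z)`. -/
noncomputable def holomorphicHermite (α : ℝ) (n : ℕ) (z : ℂ) : ℂ :=
  (Real.sqrt (2 * Real.sqrt α / (1 + α)) : ℂ) *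
    ((Real.sqrt ((1 - α) / (1 + α)) : ℝ) : ℂ) ^ n *
    (1 / (Real.sqrt (2 ^ n * n !) : ℂ)) *
    Complex.exp ((((1 - α) / (1 + α) : ℝ) : ℂ) * z ^ 2 / 2) *
    hermiteH n ((Real.sqrt (2 * α / (1 - α ^ 2)) : ℂ) * z)

section HermitePolynomial

open Polynomial

/-- The physicists' Hermite polynomials, defined by applying `2 X - d/dX` repeatedly to `1`. -/
noncomputable def hermitePoly : ℕ → ℂ[X]
  | 0 => 1
  | n + 1 => 2 * X * hermitePoly n - derivative (hermitePoly n)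

theorem hermitePoly_zero : hermitePoly 0 = 1 := rfl

theorem hermitePoly_succ (n : ℕ) :
    hermitePoly (n + 1) = 2 * X * hermitePoly n - derivative (hermitePoly n) := rfl

theorem derivative_hermitePoly_succ (n : ℕ) :
    derivative (hermitePoly (n + 1)) = C (2 * (n + 1) : ℂ) * hermitePoly n := by
  have hC : (C 2 : ℂ[X]) = 2 := map_ofNat C 2
  induction n with
  | zero => simp [hermitePoly_succ, hermitePoly_zero, hC]
  | succ n ih =>
    rw [hermitePoly_succ (n + 1), derivative_sub, derivative_mul, ih, derivative_C_mul,
      hermitePoly_succ n]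
    simp [hC]
    ring

theorem eval_hermitePoly_add_two (n : ℕ) (z : ℂ) :
    (hermitePoly (n + 2)).eval z =
      2 * z * (hermitePoly (n + 1)).eval z - 2 * (n + 1) * (hermitePoly n).eval z := by
  rw [hermitePoly_succ (n + 1), derivative_hermitePoly_succ]
  simp

/-- The `m`-th term of `H_n(z) / n!`, extended by zero. -/
noncomputable def hermiteTerm (z : ℂ) (n m : ℕ) : ℂ :=
  if 2 * m ≤ n then ((-1 : ℂ) ^ m * (2 * z) ^ (n - 2 * m)) / ((m ! : ℂ) * ((n - 2 * m)! : ℂ))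
  else 0

theorem hermiteH_eq_sum_hermiteTerm {n N : ℕ} (h : n / 2 + 1 ≤ N) (z : ℂ) :
    hermiteH n z = n ! * ∑ m ∈ range N, hermiteTerm z n m := by
  rw [hermiteH]
  congr 1
  calc _ = ∑ m ∈ range (n / 2 + 1), hermiteTerm z n m := by
        refine Finset.sum_congr rfl fun m hm => ?_
        rw [Finset.mem_range] at hm
        rw [hermiteTerm, if_pos (by lia)]
    _ = _ := by
        refine Finset.sum_subset (Finset.range_subset_range.2 h) fun m _ hm => ?_
        rw [Finset.mem_range] at hm
        rw [hermiteTerm, if_neg (by lia)]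

theorem hermiteTerm_add_two_zero (z : ℂ) (n : ℕ) :
    (n + 2) * hermiteTerm z (n + 2) 0 = 2 * z * hermiteTerm z (n + 1) 0 := by
  have h1 : (n : ℂ) + 1 + 1 ≠ 0 := by exact_mod_cast Nat.succ_ne_zero (n + 1)
  simp only [hermiteTerm, mul_zero, Nat.zero_le, if_true, Nat.sub_zero]
  rw [Nat.factorial_succ (n + 1)]
  have h2 : (((n + 1)! : ℕ) : ℂ) ≠ 0 := by exact_mod_cast Nat.factorial_ne_zero _
  push_cast
  field_simp
  ring

theorem hermiteTerm_add_two_succ (z : ℂ) (n m : ℕ) :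
    (n + 2) * hermiteTerm z (n + 2) (m + 1) =
      2 * z * hermiteTerm z (n + 1) (m + 1) - 2 * hermiteTerm z n m := by
  have hm : (m : ℂ) + 1 ≠ 0 := by exact_mod_cast Nat.succ_ne_zero m
  have hm' : ((m ! : ℕ) : ℂ) ≠ 0 := by exact_mod_cast Nat.factorial_ne_zero _
  rcases lt_trichotomy n (2 * m) with h | rfl | h
  · simp [hermiteTerm, show ¬ 2 * (m + 1) ≤ n + 2 by lia, show ¬ 2 * (m + 1) ≤ n + 1 by lia,
      show ¬ 2 * m ≤ n by lia]
  · simp only [hermiteTerm, show 2 * (m + 1) ≤ 2 * m + 2 by lia,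
      show ¬ 2 * (m + 1) ≤ 2 * m + 1 by lia, show 2 * m + 2 - 2 * (m + 1) = 0 by lia,
      Nat.sub_self, le_refl, if_true, if_false, Nat.factorial_succ m]
    push_cast
    field_simp
    simp
    ring
  · obtain ⟨j, rfl⟩ : ∃ j, n = 2 * m + (j + 1) := ⟨n - 2 * m - 1, by lia⟩
    have hj : (j : ℂ) + 1 ≠ 0 := by exact_mod_cast Nat.succ_ne_zero j
    have hj' : ((j ! : ℕ) : ℂ) ≠ 0 := by exact_mod_cast Nat.factorial_ne_zero _
    simp only [hermiteTerm, show 2 * (m + 1) ≤ 2 * m + (j + 1) + 2 by lia,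
      show 2 * (m + 1) ≤ 2 * m + (j + 1) + 1 by lia, show 2 * m ≤ 2 * m + (j + 1) by lia,
      show 2 * m + (j + 1) + 2 - 2 * (m + 1) = j + 1 by lia,
      show 2 * m + (j + 1) + 1 - 2 * (m + 1) = j by lia,
      show 2 * m + (j + 1) - 2 * m = j + 1 by lia, if_true, Nat.factorial_succ]
    push_cast
    field_simp
    ring

theorem hermiteH_add_two (n : ℕ) (z : ℂ) :
    hermiteH (n + 2) z = 2 * z * hermiteH (n + 1) z - 2 * (n + 1) * hermiteH n z := by
  rw [hermiteH_eq_sum_hermiteTerm (n := n + 2) (N := n + 3) (by lia),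
    hermiteH_eq_sum_hermiteTerm (n := n + 1) (N := n + 3) (by lia),
    hermiteH_eq_sum_hermiteTerm (n := n) (N := n + 2) (by lia)]
  have key : ((n : ℂ) + 2) * ∑ m ∈ range (n + 3), hermiteTerm z (n + 2) m =
      2 * z * ∑ m ∈ range (n + 3), hermiteTerm z (n + 1) m -
        2 * ∑ m ∈ range (n + 2), hermiteTerm z n m := by
    rw [Finset.sum_range_succ' _ (n + 2), Finset.sum_range_succ' _ (n + 2), mul_add, mul_add,
      hermiteTerm_add_two_zero, Finset.mul_sum, Finset.mul_sum, Finset.mul_sum,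
      Finset.sum_congr rfl fun m _ => hermiteTerm_add_two_succ z n m, Finset.sum_sub_distrib]
    ring
  rw [Nat.factorial_succ (n + 1), Nat.factorial_succ n]
  push_cast
  linear_combination ((n : ℂ) + 1) * (n ! : ℂ) * key

theorem hermiteH_eq_eval (n : ℕ) (z : ℂ) : hermiteH n z = (hermitePoly n).eval z := by
  induction n using Nat.twoStepInduction with
  | zero => simp [hermiteH, hermitePoly_zero]
  | one => simp [hermiteH, hermitePoly_succ, hermitePoly_zero]
  | more n ih1 ih2 => rw [hermiteH_add_two, ih1, ih2, eval_hermitePoly_add_two]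

end HermitePolynomial

section GaussianPairing

open Polynomial ComplexConjugate

/-- The Gaussian weight `exp (-a x² - b y²)` on the plane. -/
noncomputable def gaussianWeight (a b : ℝ) (p : ℝ × ℝ) : ℂ :=
  Complex.exp (-a * p.1 ^ 2 - b * p.2 ^ 2)

/-- `f(z) conj(g(z)) exp (-a x² - b y²)` with `z = x + i y`. -/
noncomputable def pairingIntegrand (a b : ℝ) (f g : ℂ[X]) (p : ℝ × ℝ) : ℂ :=
  f.eval (p.1 + p.2 * Complex.I) * conj (g.eval (p.1 + p.2 * Complex.I)) * gaussianWeight a b p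

/-- The sesquilinear pairing of polynomials in `z = x + i y` with respect to the weight
`exp (-a x² - b y²)`. -/
noncomputable def gaussianPairing (a b : ℝ) (f g : ℂ[X]) : ℂ :=
  ∫ p, pairingIntegrand a b f g p

theorem integrable_pow_mul_exp_neg_mul_sq {a : ℝ} (ha : 0 < a) (j : ℕ) :
    Integrable fun x : ℝ => (x : ℂ) ^ j * Complex.exp (-a * x ^ 2) := by
  have h := (integrable_rpow_mul_exp_neg_mul_sq ha
    (s := j) (by linarith [j.cast_nonneg (α := ℝ)])).ofReal (𝕜 := ℂ)
  simpa using h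

theorem integrable_monomial_mul_gaussianWeight {a b : ℝ} (ha : 0 < a) (hb : 0 < b) (j k : ℕ) :
    Integrable fun p : ℝ × ℝ => (p.1 : ℂ) ^ j * (p.2 : ℂ) ^ k * gaussianWeight a b p := by
  refine ((integrable_pow_mul_exp_neg_mul_sq ha j).mul_prod
    (integrable_pow_mul_exp_neg_mul_sq hb k)).congr (.of_forall fun p => ?_)
  simp only [gaussianWeight]
  rw [sub_eq_add_neg, ← neg_mul, Complex.exp_add]
  ring

theorem integrable_monomial_mul_eval_mul {w : ℝ × ℝ → ℂ}
    (hw : ∀ j k : ℕ, Integrable fun p : ℝ × ℝ => (p.1 : ℂ) ^ j * (p.2 : ℂ) ^ k * w p)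
    (c : ℂ) (f : ℂ[X]) (j k : ℕ) :
    Integrable fun p : ℝ × ℝ =>
      (p.1 : ℂ) ^ j * (p.2 : ℂ) ^ k * (f.eval (p.1 + p.2 * c) * w p) := by
  induction f using Polynomial.induction_on' generalizing j k with
  | add f g hf hg =>
    refine ((hf j k).add (hg j k)).congr (.of_forall fun p => ?_)
    simp only [Pi.add_apply, eval_add]
    ring
  | monomial n r =>
    induction n generalizing j k with
    | zero =>
      refine ((hw j k).const_mul r).congr (.of_forall fun p => ?_)
      simp only [eval_monomial]
      ring
    | succ n ih =>
      refine ((ih (j + 1) k).add ((ih j (k + 1)).const_mul c)).congr (.of_forall fun p => ?_)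
      simp only [Pi.add_apply, eval_monomial]
      ring

theorem integrable_monomial_mul_pairingIntegrand {a b : ℝ} (ha : 0 < a) (hb : 0 < b)
    (f g : ℂ[X]) (j k : ℕ) :
    Integrable fun p : ℝ × ℝ => (p.1 : ℂ) ^ j * (p.2 : ℂ) ^ k * pairingIntegrand a b f g p := by
  refine (integrable_monomial_mul_eval_mul (fun j k => integrable_monomial_mul_eval_mul
    (integrable_monomial_mul_gaussianWeight ha hb) (-Complex.I) (g.map (starRingEnd ℂ)) j k)
    Complex.I f j k).congr (.of_forall fun p => ?_)
  have : (p.1 : ℂ) + p.2 * -Complex.I = conj ((p.1 : ℂ) + p.2 * Complex.I) := by simp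
  simp only [pairingIntegrand, this, eval_map_apply]
  ring

theorem integrable_pairingIntegrand {a b : ℝ} (ha : 0 < a) (hb : 0 < b) (f g : ℂ[X]) :
    Integrable (pairingIntegrand a b f g) := by
  simpa using integrable_monomial_mul_pairingIntegrand ha hb f g 0 0

theorem integrable_fst_mul_pairingIntegrand {a b : ℝ} (ha : 0 < a) (hb : 0 < b) (f g : ℂ[X]) :
    Integrable fun p : ℝ × ℝ => (p.1 : ℂ) * pairingIntegrand a b f g p := by
  simpa using integrable_monomial_mul_pairingIntegrand ha hb f g 1 0

theorem integrable_snd_mul_pairingIntegrand {a b : ℝ} (ha : 0 < a) (hb : 0 < b) (f g : ℂ[X]) :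
    Integrable fun p : ℝ × ℝ => (p.2 : ℂ) * pairingIntegrand a b f g p := by
  simpa using integrable_monomial_mul_pairingIntegrand ha hb f g 0 1

theorem integral_eq_zero_of_hasLineDerivAt {Φ Φ' : ℝ × ℝ → ℂ} {v : ℝ × ℝ}
    (hΦ : Integrable Φ) (hΦ' : Integrable Φ') (h : ∀ p, HasLineDerivAt ℝ Φ (Φ' p) p v) :
    ∫ p, Φ' p = 0 := by
  have := integral_bilinear_hasLineDerivAt_right_eq_neg_left_of_integrable
    (μ := (volume : Measure (ℝ × ℝ))) (f := fun _ => (1 : ℂ)) (f' := fun _ => 0) (v := v)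
    (B := ContinuousLinearMap.mul ℝ ℂ) (g := Φ) (g' := Φ') (by simp) (by simpa using hΦ')
    (by simpa using hΦ) (fun p _ => by simpa using (hasFDerivAt_const (1 : ℂ) p).hasLineDerivAt v)
    (fun p _ => h p)
  simpa using this

/-- The derivative of the integrand in the direction `v`. -/
theorem hasLineDerivAt_pairingIntegrand (a b : ℝ) (f g : ℂ[X]) (p v : ℝ × ℝ) :
    HasLineDerivAt ℝ (pairingIntegrand a b f g)
      ((v.1 + v.2 * Complex.I) * pairingIntegrand a b (derivative f) g p +
        (v.1 - v.2 * Complex.I) * pairingIntegrand a b f (derivative g) p -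
        2 * (a * v.1 * p.1 + b * v.2 * p.2) * pairingIntegrand a b f g p) p v := by
  have hx : HasDerivAt (fun t : ℝ => ((p.1 + t * v.1 : ℝ) : ℂ)) v.1 0 :=
    HasDerivAt.ofReal_comp (by simpa using ((hasDerivAt_id (0 : ℝ)).mul_const v.1).const_add p.1)
  have hy : HasDerivAt (fun t : ℝ => ((p.2 + t * v.2 : ℝ) : ℂ)) v.2 0 :=
    HasDerivAt.ofReal_comp (by simpa using ((hasDerivAt_id (0 : ℝ)).mul_const v.2).const_add p.2)
  have hz := hx.add (hy.mul_const Complex.I)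
  have hf := (f.hasDerivAt _).comp (0 : ℝ) hz
  have hg := ((g.hasDerivAt _).comp (0 : ℝ) hz).star_conj
  have hw := (((hx.pow 2).const_mul (-a : ℂ)).sub ((hy.pow 2).const_mul (b : ℂ))).cexp
  rw [HasLineDerivAt]
  convert! (hf.mul hg).mul hw using 1
  · simp [pairingIntegrand, gaussianWeight]
    ring

theorem gaussianPairing_fst {a b : ℝ} (ha : 0 < a) (hb : 0 < b) (f g : ℂ[X]) :
    2 * a * ∫ p : ℝ × ℝ, (p.1 : ℂ) * pairingIntegrand a b f g p =
      gaussianPairing a b (derivative f) g + gaussianPairing a b f (derivative g) := by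
  have h0 := integrable_pairingIntegrand ha hb f g
  have h1 := integrable_pairingIntegrand ha hb (derivative f) g
  have h2 := integrable_pairingIntegrand ha hb f (derivative g)
  have h3 := (integrable_fst_mul_pairingIntegrand ha hb f g).const_mul (2 * a : ℂ)
  have h := integral_eq_zero_of_hasLineDerivAt h0 ((h1.add h2).sub h3) (v := (1, 0)) fun p => by
    convert hasLineDerivAt_pairingIntegrand a b f g p (1, 0) using 1
    simp
    ring
  rw [integral_sub' (h1.add h2) h3, integral_add' h1 h2, integral_const_mul] at h
  simp only [gaussianPairing]
  linear_combination -h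

theorem gaussianPairing_snd {a b : ℝ} (ha : 0 < a) (hb : 0 < b) (f g : ℂ[X]) :
    2 * b * ∫ p : ℝ × ℝ, (p.2 : ℂ) * pairingIntegrand a b f g p =
      Complex.I * (gaussianPairing a b (derivative f) g - gaussianPairing a b f (derivative g)) := by
  have h0 := integrable_pairingIntegrand ha hb f g
  have h1 := (integrable_pairingIntegrand ha hb (derivative f) g).const_mul Complex.I
  have h2 := (integrable_pairingIntegrand ha hb f (derivative g)).const_mul Complex.I
  have h3 := (integrable_snd_mul_pairingIntegrand ha hb f g).const_mul (2 * b : ℂ)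
  have h := integral_eq_zero_of_hasLineDerivAt h0 ((h1.sub h2).sub h3) (v := (0, 1)) fun p => by
    convert hasLineDerivAt_pairingIntegrand a b f g p (0, 1) using 1
    simp
    ring
  rw [integral_sub' (h1.sub h2) h3, integral_sub' h1 h2, integral_const_mul, integral_const_mul,
    integral_const_mul] at h
  simp only [gaussianPairing]
  linear_combination -h

theorem gaussianPairing_sub_left {a b : ℝ} (ha : 0 < a) (hb : 0 < b) (f₁ f₂ g : ℂ[X]) :
    gaussianPairing a b (f₁ - f₂) g = gaussianPairing a b f₁ g - gaussianPairing a b f₂ g := by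
  simp only [gaussianPairing]
  rw [← integral_sub (integrable_pairingIntegrand ha hb f₁ g)
    (integrable_pairingIntegrand ha hb f₂ g)]
  congr 1 with p
  simp only [pairingIntegrand, eval_sub]
  ring

theorem gaussianPairing_conj_symm (a b : ℝ) (f g : ℂ[X]) :
    conj (gaussianPairing a b f g) = gaussianPairing a b g f := by
  simp only [gaussianPairing]
  rw [← integral_conj]
  congr 1 with p
  simp only [pairingIntegrand, gaussianWeight, map_mul, ← Complex.exp_conj, Complex.conj_conj]
  simp
  ring

theorem gaussianPairing_C_mul_right (a b c : ℝ) (f g : ℂ[X]) :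
    gaussianPairing a b f (C (c : ℂ) * g) = c * gaussianPairing a b f g := by
  simp only [gaussianPairing]
  rw [← integral_const_mul]
  congr 1 with p
  simp only [pairingIntegrand, eval_mul, eval_C, map_mul, Complex.conj_ofReal]
  ring

/-- If `1/a - 1/b = 1`, the adjoint of `2 z - d/dz` is a multiple of `d/dz`. -/
theorem gaussianPairing_raise_left {a b : ℝ} (ha : 0 < a) (hb : 0 < b) (hab : a⁻¹ - b⁻¹ = 1)
    (f g : ℂ[X]) :
    gaussianPairing a b (2 * X * f - derivative f) g =
      (a⁻¹ + b⁻¹ : ℝ) * gaussianPairing a b f (derivative g) := by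
  have hx := gaussianPairing_fst ha hb f g
  have hy := gaussianPairing_snd ha hb f g
  have hz : gaussianPairing a b (2 * X * f) g =
      2 * (∫ p : ℝ × ℝ, (p.1 : ℂ) * pairingIntegrand a b f g p) +
        2 * Complex.I * ∫ p : ℝ × ℝ, (p.2 : ℂ) * pairingIntegrand a b f g p := by
    rw [← integral_const_mul, ← integral_const_mul, ← integral_add
      ((integrable_fst_mul_pairingIntegrand ha hb f g).const_mul _)
      ((integrable_snd_mul_pairingIntegrand ha hb f g).const_mul _), gaussianPairing]
    congr 1 with p
    simp only [pairingIntegrand, eval_mul, eval_X, eval_ofNat]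
    ring
  have ha' : (a : ℂ) ≠ 0 := by exact_mod_cast ha.ne'
  have hb' : (b : ℂ) ≠ 0 := by exact_mod_cast hb.ne'
  have hab' : (a : ℂ)⁻¹ - (b : ℂ)⁻¹ = 1 := by exact_mod_cast hab
  have haa : (a : ℂ) * (a : ℂ)⁻¹ = 1 := mul_inv_cancel₀ ha'
  have hbb : (b : ℂ) * (b : ℂ)⁻¹ = 1 := mul_inv_cancel₀ hb'
  rw [gaussianPairing_sub_left ha hb, hz]
  push_cast
  linear_combination (a : ℂ)⁻¹ * hx + Complex.I * (b : ℂ)⁻¹ * hy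
    - 2 * (∫ p : ℝ × ℝ, (p.1 : ℂ) * pairingIntegrand a b f g p) * haa
    - 2 * Complex.I * (∫ p : ℝ × ℝ, (p.2 : ℂ) * pairingIntegrand a b f g p) * hbb
    + gaussianPairing a b (derivative f) g * hab'
    + (b : ℂ)⁻¹ * (gaussianPairing a b (derivative f) g - gaussianPairing a b f (derivative g))
      * Complex.I_mul_I

theorem gaussianPairing_one_one {a : ℝ} (ha : 0 < a) (b : ℝ) :
    gaussianPairing a b 1 1 = (Real.pi / √(a * b) : ℝ) := by
  have h : ∀ p : ℝ × ℝ, pairingIntegrand a b 1 1 p =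
      ((Real.exp (-a * p.1 ^ 2) * Real.exp (-b * p.2 ^ 2) : ℝ) : ℂ) := fun p => by
    simp only [pairingIntegrand, gaussianWeight, ← Real.exp_add]
    push_cast
    simp [sub_eq_add_neg]
  rw [gaussianPairing, integral_congr_ae (.of_forall h), integral_complex_ofReal, Measure.volume_eq_prod,
    integral_prod_mul (fun x : ℝ => Real.exp (-a * x ^ 2)) fun x : ℝ => Real.exp (-b * x ^ 2),
    integral_gaussian, integral_gaussian, ← Real.sqrt_mul (by positivity), div_mul_div_comm,
    Real.sqrt_div (by positivity), Real.sqrt_mul_self Real.pi_pos.le]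

theorem gaussianPairing_hermitePoly {a b : ℝ} (ha : 0 < a) (hb : 0 < b) (hab : a⁻¹ - b⁻¹ = 1)
    (m n : ℕ) :
    gaussianPairing a b (hermitePoly m) (hermitePoly n) =
      if m = n then (((2 * (a⁻¹ + b⁻¹)) ^ n * n ! * (Real.pi / √(a * b)) : ℝ) : ℂ) else 0 := by
  have succ_zero (m : ℕ) : gaussianPairing a b (hermitePoly (m + 1)) (hermitePoly 0) = 0 := by
    rw [hermitePoly_succ, gaussianPairing_raise_left ha hb hab, hermitePoly_zero, derivative_one]
    simp [gaussianPairing, pairingIntegrand]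
  induction m generalizing n with
  | zero =>
    cases n with
    | zero => simp [hermitePoly_zero, gaussianPairing_one_one ha b]
    | succ n => rw [← gaussianPairing_conj_symm, succ_zero]; simp
  | succ m ih =>
    cases n with
    | zero => rw [succ_zero]; simp
    | succ n =>
      have hn : (2 * (n + 1) : ℂ) = ((2 * (n + 1) : ℝ) : ℂ) := by push_cast; rfl
      rw [hermitePoly_succ m, gaussianPairing_raise_left ha hb hab, derivative_hermitePoly_succ,
        hn, gaussianPairing_C_mul_right, ih]
      by_cases h : m = n
      · simp only [h, if_true, Nat.factorial_succ]
        push_cast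
        ring
      · simp [h]

theorem integral_integral_pairingIntegrand_mul {a b : ℝ} (ha : 0 < a) (hb : 0 < b) (c : ℝ)
    (f g : ℂ[X]) :
    ∫ x : ℝ, ∫ y : ℝ, pairingIntegrand a b f g (c * x, c * y) =
      ((c⁻¹ ^ 2 : ℝ) : ℂ) * gaussianPairing a b f g := by
  have h (x : ℝ) := Measure.integral_comp_mul_left (fun y => pairingIntegrand a b f g (x, y)) c
  simp_rw [h, integral_smul]
  rw [Measure.integral_comp_mul_left (fun x => ∫ y, pairingIntegrand a b f g (x, y)) c,
    smul_smul, abs_mul_abs_self, gaussianPairing, Measure.volume_eq_prod,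
    integral_prod _ (integrable_pairingIntegrand ha hb f g), Complex.real_smul, pow_two]

end GaussianPairing

/-- The constant factor of `holomorphicHermite α n`. -/
noncomputable def holomorphicHermiteConst (α : ℝ) (n : ℕ) : ℝ :=
  √(2 * √α / (1 + α)) * √((1 - α) / (1 + α)) ^ n * (1 / √(2 ^ n * n !))

theorem holomorphicHermite_mul_conj {α : ℝ} (hα0 : 0 < α) (hα1 : α < 1) (m n : ℕ) (x y : ℝ) :
    holomorphicHermite α m (x + y * Complex.I) *
        (starRingEnd ℂ) (holomorphicHermite α n (x + y * Complex.I)) *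
        Real.exp (-x ^ 2 - y ^ 2) =
      (holomorphicHermiteConst α m * holomorphicHermiteConst α n : ℝ) *
        pairingIntegrand (1 - α) ((1 - α) / α) (hermitePoly m) (hermitePoly n)
          (√(2 * α / (1 - α ^ 2)) * x, √(2 * α / (1 - α ^ 2)) * y) := by
  have h1 : 1 - α ≠ 0 := by linarith
  have h2 : 1 + α ≠ 0 := by linarith
  have h3 : 1 - α ^ 2 ≠ 0 := by nlinarith
  have h4 : 0 ≤ 2 * α / (1 - α ^ 2) := div_nonneg (by linarith) (by nlinarith)
  set c := √(2 * α / (1 - α ^ 2)) with hc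
  have hc2 : c ^ 2 = 2 * α / (1 - α ^ 2) := Real.sq_sqrt h4
  set z : ℂ := x + y * Complex.I with hz
  set r := (1 - α) / (1 + α) with hr
  have hcz : ((c * x : ℝ) : ℂ) + (c * y : ℝ) * Complex.I = c * z := by rw [hz]; push_cast; ring
  have hexp : Complex.exp (r * z ^ 2 / 2) * (starRingEnd ℂ) (Complex.exp (r * z ^ 2 / 2)) *
      Real.exp (-x ^ 2 - y ^ 2) =
      gaussianWeight (1 - α) ((1 - α) / α) (c * x, c * y) := by
    have hreal : r * (x ^ 2 - y ^ 2) + (-x ^ 2 - y ^ 2) =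
        -(1 - α) * (c * x) ^ 2 - (1 - α) / α * (c * y) ^ 2 := by
      rw [mul_pow, mul_pow, hc2, hr, show 1 - α ^ 2 = (1 - α) * (1 + α) by ring]
      field_simp
      ring
    rw [gaussianWeight, ← Complex.exp_conj, ← Complex.exp_add, Complex.ofReal_exp,
      ← Complex.exp_add]
    congr 1
    have := congrArg (Complex.ofReal) hreal
    push_cast at this ⊢
    rw [← this, hz]
    simp [map_ofNat]
    linear_combination (r : ℂ) * y ^ 2 * Complex.I_sq
  simp only [pairingIntegrand]
  rw [← hexp, hcz]
  simp only [holomorphicHermite, holomorphicHermiteConst, hermiteH_eq_eval, map_mul, map_pow,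
    map_div₀, map_one, Complex.conj_ofReal, ← hc, ← hr]
  push_cast
  ring

theorem holomorphicHermiteConst_sq {α : ℝ} (hα0 : 0 < α) (hα1 : α < 1) (n : ℕ) :
    holomorphicHermiteConst α n ^ 2 =
      2 * √α / (1 + α) * ((1 - α) / (1 + α)) ^ n / (2 ^ n * n !) := by
  have h : 0 ≤ (1 - α) / (1 + α) := div_nonneg (by linarith) (by linarith)
  rw [holomorphicHermiteConst, mul_pow, mul_pow, div_pow, Real.sq_sqrt (by positivity),
    Real.sq_sqrt (by positivity), ← pow_mul, mul_comm n, pow_mul, Real.sq_sqrt h]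
  ring

/-- The holomorphic Hermite functions `h_n^{(α)}` form an orthonormal system in
`L²(ℂ, π^{−1} e^{−|z|²} dx dy)`: for `0 < α < 1`,
`π^{−1} ∫_{ℝ²} h_m^{(α)}(x+iy) conj(h_n^{(α)}(x+iy)) e^{−x²−y²} dx dy = δ_{mn}`. -/
theorem holomorphicHermite_orthonormal (α : ℝ) (hα0 : 0 < α) (hα1 : α < 1) (m n : ℕ) :
    ((Real.pi : ℂ))⁻¹ * ∫ x : ℝ, ∫ y : ℝ,
        holomorphicHermite α m (x + y * Complex.I) *
          (starRingEnd ℂ) (holomorphicHermite α n (x + y * Complex.I)) *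
          Real.exp (-x ^ 2 - y ^ 2) =
      if m = n then 1 else 0 := by
  have h1 : 0 < 1 - α := by linarith
  have hb : 0 < (1 - α) / α := by positivity
  have hab : (1 - α)⁻¹ - ((1 - α) / α)⁻¹ = 1 := by field_simp
  simp_rw [holomorphicHermite_mul_conj hα0 hα1, integral_const_mul]
  rw [integral_integral_pairingIntegrand_mul h1 hb, gaussianPairing_hermitePoly h1 hb hab]
  split_ifs with h
  · subst h
    rw [← pow_two, holomorphicHermiteConst_sq hα0 hα1]
    have hsq : √((1 - α) * ((1 - α) / α)) = (1 - α) / √α := by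
      rw [← mul_div_assoc, Real.sqrt_div (by positivity), Real.sqrt_mul_self h1.le]
    have hκ : (1 - α)⁻¹ + ((1 - α) / α)⁻¹ = (1 + α) / (1 - α) := by field_simp
    have hc : (√(2 * α / (1 - α ^ 2)))⁻¹ ^ 2 = (1 - α) * (1 + α) / (2 * α) := by
      rw [inv_pow, Real.sq_sqrt (div_nonneg (by linarith) (by nlinarith)), inv_div]
      ring
    rw [hsq, hκ, hc]
    norm_cast
    have hα : √α ^ 2 = α := Real.sq_sqrt hα0.le
    have hs : 0 < √α := Real.sqrt_pos.2 hα0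
    have hπ := Real.pi_pos
    rw [div_pow, mul_pow, div_pow]
    field_simp
    rw [hα]
    push_cast
    ring
  · simp
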